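/- arXiv:1408.6823 — 3 statements merged into one kernel-verified Lean document; each statement's English description precedes it below -/
import Mathlib

section
/- The patterns 0021 and 1012 are Wilf equivalent for ascent sequences: for every integer n ≥ 1, the number of ascent sequences of length n avoiding 0021 equals the number of ascent sequences of length n avoiding 1012, i.e., |𝒜_{0021}(n)| = |𝒜_{1012}(n)|. -/
/-- The number of ascents of the integer sequence `x`, i.e. the number of
positions `j` with `x j < x (j+1)`. -/
def numAscents (x : List ℕ) : ℕ :=
  ((List.zip x x.tail).filter (fun p => decide (p.1 < p.2))).length

/-- `x` is an ascent sequence: it starts with `0` and each subsequent entry is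
at most one more than the number of ascents of the preceding prefix. -/
def IsAscentSeq (x : List ℕ) : Prop :=
  x.head? = some 0 ∧
    ∀ i, 0 < i → i < x.length → x.getD i 0 ≤ numAscents (x.take i) + 1

/-- `x` contains the pattern `p`: some subsequence of `x` is order-isomorphic
to `p`. -/
def Contains (x p : List ℕ) : Prop :=
  ∃ u : List ℕ, u.Sublist x ∧ u.length = p.length ∧
    ∀ s t, s < p.length → t < p.length →
      (u.getD s 0 < u.getD t 0 ↔ p.getD s 0 < p.getD t 0) ∧
      (u.getD s 0 = u.getD t 0 ↔ p.getD s 0 = p.getD t 0)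

/-- `x` avoids the pattern `p`. -/
def Avoids (x p : List ℕ) : Prop := ¬ Contains x p

/-- The set `𝒜_B(n)` of ascent sequences of length `n` avoiding every pattern
in the list `B`. -/
def AvSet (B : List (List ℕ)) (n : ℕ) : Set (List ℕ) :=
  {x | x.length = n ∧ IsAscentSeq x ∧ ∀ p ∈ B, Avoids x p}


/-! ## Counting levels of a generating tree -/

/-- Number of descendants at depth `m` of `x`. -/
def treeCnt {α : Type*} (ch : α → Finset α) : ℕ → α → ℕ
  | 0, _ => 1
  | m + 1, x => ∑ y ∈ ch x, treeCnt ch m y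

theorem tree_count {α : Type*} [DecidableEq α] (ch : α → Finset α) (par : α → α)
    (hpar : ∀ x y, y ∈ ch x → par y = x) (S : ℕ → Set α) (r : α) (h0 : S 0 = {r})
    (hs : ∀ m y, y ∈ S (m + 1) ↔ ∃ x ∈ S m, y ∈ ch x) (m : ℕ) :
    (S m).ncard = treeCnt ch m r := by
  have key : ∀ m, ∃ T : Finset α, (T : Set α) = S m ∧
      ∀ k, ∑ x ∈ T, treeCnt ch k x = treeCnt ch (m + k) r := by
    intro m
    induction m with
    | zero => exact ⟨{r}, by simp [h0], by intro k; simp⟩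
    | succ m ih =>
      obtain ⟨T, hT, hk⟩ := ih
      refine ⟨T.biUnion ch, ?_, ?_⟩
      · ext y
        rw [hs, ← hT]
        simp
      · intro k
        rw [Finset.sum_biUnion]
        · have := hk (k + 1)
          rw [show m + 1 + k = m + (k + 1) by ring, ← this]
          rfl
        · intro a _ b _ hab
          rw [Function.onFun, Finset.disjoint_left]
          intro y hy hy'
          exact hab ((hpar _ _ hy).symm.trans (hpar _ _ hy'))
  obtain ⟨T, hT, hk⟩ := key m
  rw [← hT, Set.ncard_coe_finset]
  have := hk 0
  simpa [treeCnt] using this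

theorem sum_rank (S : Finset ℕ) (f : ℕ → ℕ) :
    ∑ i ∈ S, f ((S.filter (fun j => i ≤ j)).card) = ∑ r ∈ Finset.Icc 1 S.card, f r := by
  induction S using Finset.induction_on_min with
  | empty => simp
  | insert a s ha ih =>
    have hn : a ∉ s := fun h => lt_irrefl _ (ha a h)
    rw [Finset.sum_insert hn, Finset.card_insert_of_notMem hn,
      Finset.sum_Icc_succ_top (by omega), add_comm, ← ih]
    congr 1
    · apply Finset.sum_congr rfl
      intro i hi
      congr 2
      rw [Finset.filter_insert, if_neg (by have := ha i hi; omega)]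
    · rw [Finset.filter_true_of_mem, Finset.card_insert_of_notMem hn]
      intro x hx
      rcases Finset.mem_insert.1 hx with rfl | h
      · exact le_rfl
      · exact (ha x h).le

/-! ## Lists, ascents, patterns -/

theorem numAscents_cons_cons (a b : ℕ) (l : List ℕ) :
    numAscents (a :: b :: l) = (if a < b then 1 else 0) + numAscents (b :: l) := by
  unfold numAscents
  by_cases h : a < b <;> simp [h, add_comm]

theorem numAscents_single (b : ℕ) : numAscents [b] = 0 := rfl

theorem numAscents_snoc (l : List ℕ) (b c : ℕ) :
    numAscents (l ++ [b] ++ [c]) = numAscents (l ++ [b]) + if b < c then 1 else 0 := by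
  induction l with
  | nil => simp [numAscents_cons_cons, numAscents_single]
  | cons a l ih =>
    cases l with
    | nil => simp [numAscents_cons_cons, numAscents_single]
    | cons d l =>
      simp only [List.cons_append] at ih ⊢
      rw [numAscents_cons_cons, numAscents_cons_cons, ih]
      ring

theorem isAscentSeq_snoc (x : List ℕ) (c : ℕ) (hx : x ≠ []) :
    IsAscentSeq (x ++ [c]) ↔ IsAscentSeq x ∧ c ≤ numAscents x + 1 := by
  unfold IsAscentSeq
  rw [List.head?_append_of_ne_nil _ hx]
  have hpos : 0 < x.length := List.length_pos_iff.2 hx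
  constructor
  · rintro ⟨h1, h2⟩
    refine ⟨⟨h1, ?_⟩, ?_⟩
    · intro i hi hl
      have := h2 i hi (by simp; omega)
      rw [List.getD_append _ _ _ _ hl, List.take_append_of_le_length hl.le] at this
      exact this
    · have := h2 x.length hpos (by simp)
      rw [List.getD_append_right _ _ _ _ le_rfl, List.take_append_of_le_length le_rfl] at this
      simpa using this
  · rintro ⟨⟨h1, h2⟩, h3⟩
    refine ⟨h1, ?_⟩
    intro i hi hl
    simp at hl
    rcases Nat.lt_or_ge i x.length with h | h
    · rw [List.getD_append _ _ _ _ h, List.take_append_of_le_length h.le]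
      exact h2 i hi h
    · have : i = x.length := by omega
      subst this
      rw [List.getD_append_right _ _ _ _ le_rfl, List.take_append_of_le_length le_rfl]
      simpa using h3

theorem isAscentSeq_single (a : ℕ) : IsAscentSeq [a] ↔ a = 0 := by
  unfold IsAscentSeq
  constructor
  · rintro ⟨h, _⟩
    simpa using h
  · rintro rfl
    refine ⟨rfl, ?_⟩
    intro i h1 h2
    simp at h2
    omega

theorem sub_snoc (l x : List ℕ) (c e : ℕ) :
    (l ++ [c]).Sublist (x ++ [e]) ↔ (l ++ [c]).Sublist x ∨ (c = e ∧ l.Sublist x) := by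
  rw [← List.reverse_sublist, List.reverse_append, List.reverse_append]
  simp only [List.reverse_cons, List.reverse_nil, List.nil_append, List.singleton_append]
  rw [List.sublist_cons_iff]
  constructor
  · rintro (h | ⟨r, h1, h2⟩)
    · left
      rw [← List.reverse_sublist]
      simpa using h
    · right
      simp only [List.cons.injEq] at h1
      refine ⟨h1.1, ?_⟩
      rw [← List.reverse_sublist, h1.2]
      exact h2
  · rintro (h | ⟨h1, h2⟩)
    · left
      rw [← List.reverse_sublist] at h
      simpa using h
    · right
      exact ⟨l.reverse, by simp [h1], by simpa using h2⟩

theorem contains_0021 (x : List ℕ) :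
    Contains x [0, 0, 2, 1] ↔ ∃ a c b, a < c ∧ c < b ∧ [a, a, b, c].Sublist x := by
  constructor
  · rintro ⟨u, hu, hl, h⟩
    match u, hl with
    | [p, q, r, s], _ =>
      have h1 := (h 0 1 (by simp) (by simp)).2
      have h2 := (h 0 3 (by simp) (by simp)).1
      have h3 := (h 3 2 (by simp) (by simp)).1
      simp at h1 h2 h3
      subst h1
      exact ⟨p, s, r, h2, h3, hu⟩
  · rintro ⟨a, c, b, h1, h2, hs⟩
    refine ⟨_, hs, rfl, ?_⟩
    intro s t hs ht
    simp at hs ht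
    interval_cases s <;> interval_cases t <;> simp <;> omega

theorem contains_1012 (x : List ℕ) :
    Contains x [1, 0, 1, 2] ↔ ∃ u v w, u < v ∧ v < w ∧ [v, u, v, w].Sublist x := by
  constructor
  · rintro ⟨u, hu, hl, h⟩
    match u, hl with
    | [p, q, r, s], _ =>
      have h1 := (h 0 2 (by simp) (by simp)).2
      have h2 := (h 1 0 (by simp) (by simp)).1
      have h3 := (h 2 3 (by simp) (by simp)).1
      simp at h1 h2 h3
      subst h1
      exact ⟨q, p, s, h2, h3, hu⟩
  · rintro ⟨a, c, b, h1, h2, hs⟩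
    refine ⟨_, hs, rfl, ?_⟩
    intro s t hs ht
    simp at hs ht
    interval_cases s <;> interval_cases t <;> simp <;> omega

/-! ## The arithmetic of the two trees -/

/-- Tree for 1012: `true` is type A, `false` is type B. -/
def ab : ℕ → Bool → ℕ → ℕ
  | 0, _, _ => 1
  | n + 1, t, k => (if t then ∑ j ∈ Finset.Icc 1 k, ab n true j else 0)
      + ab n true (k + 1) + ab n false (k + 1)

/-- Tree for 0021: `true` is type Z, `false` is type P. -/
def zp : ℕ → Bool → ℕ → ℕ → ℕ
  | 0, _, _, _ => 1
  | n + 1, t, d, k => ∑ i ∈ Finset.range (d + 1), zp n true i (d + k - i)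
      + (if t then ∑ j ∈ Finset.Icc 2 (k + 1), zp n false d j
          else zp n false d k + ∑ j ∈ Finset.Icc 2 k, zp n false d j)

/-- Initial states of the 0021 tree. -/
def zi : ℕ → ℕ → ℕ
  | 0, _ => 1
  | n + 1, d => zi n (d + 1) + ∑ i ∈ Finset.range (d + 1), zp n true i (d + 1 - i)

/-- The auxiliary one-parameter tree. -/
def pp : ℕ → ℕ → ℕ
  | 0, _ => 1
  | n + 1, k => 1 + pp n (k + 1) + pp n k + ∑ j ∈ Finset.Icc 2 k, pp n j

/-- Antidiagonal sums. -/
def zs (t : Bool) (n k : ℕ) : ℕ := ∑ d ∈ Finset.range (n + 1), zp (n - d) t d k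

/-- Second antidiagonal sums. -/
def zq (n k : ℕ) : ℕ := ∑ m ∈ Finset.range (n + 1), zs true (n - m) (k + m)

theorem zq_succ (n k : ℕ) : zq (n + 1) k = zs true (n + 1) k + zq n (k + 1) := by
  unfold zq
  rw [Finset.sum_range_succ', add_comm]
  congr 1
  apply Finset.sum_congr rfl
  intro m hm
  congr 1 <;> omega

theorem zq_eq (n k : ℕ) : zq n k =
    ∑ d ∈ Finset.range (n + 1), ∑ i ∈ Finset.range (d + 1), zp (n - d) true i (d + k - i) := by
  unfold zq zs
  rw [Finset.sum_sigma', Finset.sum_sigma']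
  refine Finset.sum_bij' (fun p _ => ⟨p.1 + p.2, p.2⟩) (fun p _ => ⟨p.1 - p.2, p.2⟩) ?_ ?_ ?_ ?_ ?_
  · rintro ⟨a, b⟩ h
    simp at h ⊢
    omega
  · rintro ⟨a, b⟩ h
    simp at h ⊢
    omega
  · rintro ⟨a, b⟩ h
    simp
  · rintro ⟨a, b⟩ h
    simp at h ⊢
    omega
  · rintro ⟨a, b⟩ h
    simp at h ⊢
    congr 1 <;> omega

theorem zs_true_succ (n k : ℕ) :
    zs true (n + 1) k = 1 + zq n k + ∑ j ∈ Finset.Icc 2 (k + 1), zs false n j := by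
  rw [zq_eq]
  unfold zs
  rw [Finset.sum_range_succ, Finset.sum_comm, add_assoc, ← Finset.sum_add_distrib, add_comm]
  congr 1
  · simp [zp]
  · apply Finset.sum_congr rfl
    intro d hd
    simp at hd
    rw [show n + 1 - d = (n - d) + 1 by omega]
    simp [zp]

theorem zs_false_succ (n k : ℕ) :
    zs false (n + 1) k =
      1 + zq n k + (zs false n k + ∑ j ∈ Finset.Icc 2 k, zs false n j) := by
  rw [zq_eq]
  unfold zs
  rw [Finset.sum_range_succ, Finset.sum_comm, add_assoc, ← Finset.sum_add_distrib,
    ← Finset.sum_add_distrib, add_comm]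
  congr 1
  · simp [zp]
  · apply Finset.sum_congr rfl
    intro d hd
    simp at hd
    rw [show n + 1 - d = (n - d) + 1 by omega]
    simp [zp]

theorem zq_pp (n : ℕ) : ∀ k, zs false n k = pp n k ∧ zq n k = pp n (k + 1) := by
  induction n with
  | zero => intro k; simp [zs, zq, zp, pp]
  | succ n ih =>
    intro k
    have h1 : zs false (n + 1) k = pp (n + 1) k := by
      rw [zs_false_succ, (ih k).1, (ih k).2, pp]
      simp only [fun j => (ih j).1]
      ring
    refine ⟨h1, ?_⟩
    rw [zq_succ, zs_true_succ, (ih k).2, (ih (k + 1)).2, pp]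
    simp only [fun j => (ih j).1]
    ring

theorem zi_eq (n d : ℕ) : zi n d = 1 + ∑ e ∈ Finset.range n,
    ∑ i ∈ Finset.range (d + e + 1), zp (n - 1 - e) true i (d + e + 1 - i) := by
  induction n generalizing d with
  | zero => simp [zi]
  | succ n ih =>
    rw [zi, ih, Finset.sum_range_succ' _ n, add_assoc]
    congr 2
    apply Finset.sum_congr rfl
    intro e he
    rw [show d + 1 + e = d + (e + 1) by ring, show n - 1 - e = n + 1 - 1 - (e + 1) by omega]

theorem zi_pp (n : ℕ) : zi (n + 1) 0 = 1 + pp n 2 := by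
  rw [zi_eq, ← (zq_pp n 1).2, zq_eq]
  simp

/-- Coefficients of the power series `ρ`. -/
def rc : ℕ → ℚ
  | 0 => 1
  | n + 1 => rc n + ∑ i : Fin (n + 1), rc i * rc (n - i) - if n = 0 then 1 else 0

open PowerSeries in
theorem rho_exists : ∃ ρ : PowerSeries ℚ, (1 - X) * ρ = 1 - X + X * ρ ^ 2 := by
  refine ⟨mk rc, ?_⟩
  have : mk rc = 1 - X + X * mk rc + X * (mk rc) ^ 2 := by
    ext n
    cases n with
    | zero => simp [rc]
    | succ n =>
      simp only [map_add, map_sub, coeff_succ_X_mul, coeff_mk]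
      rw [sq, coeff_mul]
      simp only [coeff_mk]
      rw [rc, Finset.Nat.sum_antidiagonal_eq_sum_range_succ (fun i j => rc i * rc j),
        Finset.sum_range (fun i => rc i * rc (n - i))]
      simp [coeff_one, coeff_X]
      ring
  linear_combination this

open PowerSeries in
theorem zi_eq_ab (n : ℕ) : zi n 0 = ab n false 0 := by
  obtain ⟨ρ, hρ⟩ := rho_exists
  have hρ0 : constantCoeff ρ = 1 := by
    have := congrArg constantCoeff hρ
    simpa using this
  obtain ⟨y, hy⟩ : ∃ y : PowerSeries ℚ, (1 - X) * y = 1 :=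
    ⟨(1 - X)⁻¹, PowerSeries.mul_inv_cancel _ (by simp)⟩
  obtain ⟨β, hβ⟩ : ∃ β : PowerSeries ℚ, (1 - X * ρ) * β = 1 :=
    ⟨(1 - X * ρ)⁻¹, PowerSeries.mul_inv_cancel _ (by simp)⟩
  have hy1 : y = 1 + X * y := by linear_combination hy
  have cy : ∀ n, coeff n y = 1 := by
    intro n
    induction n with
    | zero => rw [hy1]; simp
    | succ n ih => rw [hy1]; simp [coeff_succ_X_mul, ih, coeff_one]
  -- series for pp
  have hP : ∀ k, y ^ 2 * ρ ^ (k + 1) = y + X * (y ^ 2 * ρ ^ (k + 2) + y ^ 2 * ρ ^ (k + 1)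
      + ∑ j ∈ Finset.Icc 2 (k + 1), y ^ 2 * ρ ^ j) := by
    intro k
    induction k with
    | zero => simp; linear_combination y ^ 2 * hρ + y * hy
    | succ k ih =>
      rw [Finset.sum_Icc_succ_top (by omega)]
      linear_combination ih + y ^ 2 * ρ ^ (k + 1) * hρ
  have cP : ∀ n k, (pp n (k + 1) : ℚ) = coeff n (y ^ 2 * ρ ^ (k + 1)) := by
    intro n
    induction n with
    | zero =>
      intro k
      have := cy 0
      simp at this
      simp [pp, hρ0, this]
    | succ n ih =>
      intro k
      rw [hP, map_add, coeff_succ_X_mul, cy, pp]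
      push_cast
      rw [ih k, ih (k + 1), map_add, map_add, map_sum]
      rw [Finset.sum_congr rfl (g := fun j => coeff n (y ^ 2 * ρ ^ j))]
      · ring
      · intro j hj
        simp at hj
        obtain ⟨i, rfl⟩ : ∃ i, j = i + 1 := ⟨j - 1, by omega⟩
        exact ih i
  have hB : ∀ k, y * β ^ k * (ρ - 1) + y =
      1 + X * (y * ρ * β ^ (k + 1) + (y * β ^ (k + 1) * (ρ - 1) + y)) := by
    intro k
    have e : β ^ k = (1 - X * ρ) * β ^ (k + 1) := by
      rw [pow_succ]; linear_combination - β ^ k * hβ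
    rw [e]
    linear_combination hy + y * β ^ (k + 1) * hρ
  have hA : ∀ k, y * ρ * β ^ k = X * (∑ j ∈ Finset.Icc 1 k, y * ρ * β ^ j)
      + (y * β ^ k * (ρ - 1) + y) := by
    intro k
    induction k with
    | zero => simp; ring
    | succ k ih =>
      rw [Finset.sum_Icc_succ_top (by omega)]
      linear_combination ih + y * β ^ k * hβ
  have cA : ∀ n k, (ab n true k : ℚ) = coeff n (y * ρ * β ^ k) ∧
      (ab n false k : ℚ) = coeff n (y * β ^ k * (ρ - 1) + y) := by
    intro n
    induction n with
    | zero =>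
      intro k
      have h1 := cy 0
      have h2 := congrArg constantCoeff hβ
      simp at h1 h2
      simp [ab, hρ0, h1, h2]
    | succ n ih =>
      intro k
      have hb : (ab (n + 1) false k : ℚ) = coeff (n + 1) (y * β ^ k * (ρ - 1) + y) := by
        rw [hB, ab, map_add, coeff_succ_X_mul, map_add, ← (ih (k + 1)).1, ← (ih (k + 1)).2]
        simp [coeff_one]
      refine ⟨?_, hb⟩
      rw [hA, map_add, ← hb, coeff_succ_X_mul, map_sum, ab, ab]
      push_cast
      simp only [fun j => (ih j).1]
      simp
      ring
  cases n with
  | zero => rfl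
  | succ n =>
    rw [zi_pp]
    have : ((1 + pp n 2 : ℕ) : ℚ) = (ab (n + 1) false 0 : ℕ) := by
      push_cast
      rw [(cA _ _).2, cP n 1]
      have e : y * β ^ 0 * (ρ - 1) + y = y + X * (y ^ 2 * ρ ^ (1 + 1)) := by
        simp
        linear_combination y ^ 2 * hρ - y * (ρ - 1) * hy
      rw [e, map_add, coeff_succ_X_mul, cy]
    exact_mod_cast this

/-! ## The tree of 0021-avoiding ascent sequences -/

/-- `c` cannot be appended to `x` without creating 0021. -/
def Forb (x : List ℕ) (c : ℕ) : Prop := ∃ a b, a < c ∧ c < b ∧ [a, a, b].Sublist x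

open Classical in
/-- The letters that may be appended to `x`. -/
noncomputable def allowed (x : List ℕ) : Finset ℕ :=
  (Finset.range (numAscents x + 2)).filter (fun c => ¬ Forb x c)

open Classical in
/-- Children in the 0021 tree. -/
noncomputable def chZ (x : List ℕ) : Finset (List ℕ) :=
  (allowed x).image (fun c => x ++ [c])

/-- Allowed letters larger than `d`. -/
noncomputable def upper (x : List ℕ) (d : ℕ) : Finset ℕ := (allowed x).filter (fun c => d < c)

theorem mem_allowed (x : List ℕ) (c : ℕ) :
    c ∈ allowed x ↔ c ≤ numAscents x + 1 ∧ ¬ Forb x c := by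
  unfold allowed
  simp only [Finset.mem_filter, Finset.mem_range]
  constructor <;> rintro ⟨h1, h2⟩ <;> exact ⟨by omega, h2⟩

theorem mem_upper (x : List ℕ) (d c : ℕ) :
    c ∈ upper x d ↔ d < c ∧ c ≤ numAscents x + 1 ∧ ¬ Forb x c := by
  unfold upper
  rw [Finset.mem_filter, mem_allowed]
  tauto

theorem forb_snoc (x : List ℕ) (e c : ℕ) :
    Forb (x ++ [e]) c ↔ Forb x c ∨ ∃ a, a < c ∧ c < e ∧ [a, a].Sublist x := by
  unfold Forb
  constructor
  · rintro ⟨a, b, h1, h2, h3⟩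
    rcases (sub_snoc [a, a] x b e).1 h3 with h | ⟨rfl, h⟩
    · exact Or.inl ⟨a, b, h1, h2, h⟩
    · exact Or.inr ⟨a, h1, h2, h⟩
  · rintro (⟨a, b, h1, h2, h3⟩ | ⟨a, h1, h2, h3⟩)
    · exact ⟨a, b, h1, h2, (sub_snoc [a, a] x b e).2 (Or.inl h3)⟩
    · exact ⟨a, e, h1, h2, (sub_snoc [a, a] x e e).2 (Or.inr ⟨rfl, h3⟩)⟩

theorem rep_snoc (x : List ℕ) (e a : ℕ) :
    [a, a].Sublist (x ++ [e]) ↔ [a, a].Sublist x ∨ (a = e ∧ a ∈ x) := by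
  have := sub_snoc [a] x a e
  simpa using this

theorem treeCnt_chZ (m : ℕ) (x : List ℕ) :
    treeCnt chZ (m + 1) x = ∑ c ∈ allowed x, treeCnt chZ m (x ++ [c]) := by
  rw [treeCnt, chZ, Finset.sum_image]
  intro a _ b _ h
  simpa using h

/-- The state of a 0021-avoider with some repeated letter; `d` is the least repeated letter. -/
structure InvZ (x : List ℕ) (d k : ℕ) : Prop where
  bound : ∀ c ∈ x, c ≤ numAscents x
  low : ∀ i ≤ d, i ∈ x
  norep : ∀ i < d, ¬ [i, i].Sublist x
  rep : [d, d].Sublist x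
  card : (upper x d).card = k

theorem InvZ.forb_lt {x : List ℕ} {c : ℕ} (h : ∀ c ∈ x, c ≤ numAscents x) (hf : Forb x c) :
    c < numAscents x := by
  obtain ⟨a, b, _, h2, h3⟩ := hf
  have : b ∈ x := h3.subset (by simp)
  have := h b this
  omega

theorem InvZ.allowed_low {x : List ℕ} {d k : ℕ} (h : InvZ x d k) :
    (allowed x).filter (fun c => ¬ d < c) = Finset.range (d + 1) := by
  ext c
  simp only [Finset.mem_filter, mem_allowed, Finset.mem_range]
  constructor
  · rintro ⟨_, h2⟩
    omega
  · intro hc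
    refine ⟨⟨?_, ?_⟩, by omega⟩
    · have := h.bound _ (h.low c (by omega))
      omega
    · rintro ⟨a, b, h1, h2, h3⟩
      refine h.norep a (by omega) (List.Sublist.trans ?_ h3)
      simp

/-- Appending a small letter. -/
theorem InvZ.append_low {l : List ℕ} {e d k i : ℕ} (h : InvZ (l ++ [e]) d k) (he : d ≤ e)
    (hi : i ≤ d) : InvZ (l ++ [e] ++ [i]) i (d + k - i) := by
  have hasc : numAscents (l ++ [e] ++ [i]) = numAscents (l ++ [e]) := by
    rw [numAscents_snoc, if_neg (by omega), add_zero]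
  set x := l ++ [e] with hx
  have hix := h.low i hi
  refine ⟨?_, ?_, ?_, ?_, ?_⟩
  · intro c hc
    rw [hasc]
    rcases List.mem_append.1 hc with hc | hc
    · exact h.bound c hc
    · simp at hc
      subst hc
      exact h.bound _ hix
  · intro j hj
    exact List.mem_append_left _ (h.low j (by omega))
  · intro j hj hs
    rcases (rep_snoc _ _ _).1 hs with hs | hs
    · exact h.norep j (by omega) hs
    · omega
  · exact (rep_snoc _ _ _).2 (Or.inr ⟨rfl, hix⟩)
  · have : upper (x ++ [i]) i = Finset.Ioc i d ∪ upper x d := by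
      ext c
      simp only [mem_upper, Finset.mem_union, Finset.mem_Ioc, hasc, forb_snoc]
      constructor
      · rintro ⟨h1, h2, h3⟩
        by_cases hcd : c ≤ d
        · exact Or.inl ⟨h1, hcd⟩
        · exact Or.inr ⟨by omega, h2, fun hf => h3 (Or.inl hf)⟩
      · rintro (⟨h1, h2⟩ | ⟨h1, h2, h3⟩)
        · have hb := h.bound _ (h.low c h2)
          refine ⟨h1, by omega, ?_⟩
          rintro (⟨a, b, g1, g2, g3⟩ | ⟨a, g1, g2, g3⟩)
          · exact h.norep a (by omega) (List.Sublist.trans (by simp) g3)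
          · omega
        · refine ⟨by omega, h2, ?_⟩
          rintro (hf | ⟨a, g1, g2, g3⟩)
          · exact h3 hf
          · omega
    rw [this, Finset.card_union_of_disjoint, h.card, Nat.card_Ioc]
    · omega
    · rw [Finset.disjoint_left]
      intro c h1 h2
      rw [mem_upper] at h2
      simp at h1
      omega

/-- Appending a large letter with an ascent. -/
theorem InvZ.append_high {l : List ℕ} {e d k c : ℕ} (h : InvZ (l ++ [e]) d k)
    (hc : c ∈ upper (l ++ [e]) d) (hec : e < c) :
    InvZ (l ++ [e] ++ [c]) d (((upper (l ++ [e]) d).filter (fun j => c ≤ j)).card + 1) ∧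
    c ∈ upper (l ++ [e] ++ [c]) d ∧ ∀ j ∈ upper (l ++ [e] ++ [c]) d, c ≤ j := by
  have hasc : numAscents (l ++ [e] ++ [c]) = numAscents (l ++ [e]) + 1 := by
    rw [numAscents_snoc, if_pos hec]
  set x := l ++ [e] with hx
  have hc' := (mem_upper _ _ _).1 hc
  have hU : upper (x ++ [c]) d =
      insert (numAscents x + 2) ((upper x d).filter (fun j => c ≤ j)) := by
    ext j
    simp only [mem_upper, Finset.mem_insert, Finset.mem_filter, hasc, forb_snoc]
    constructor
    · rintro ⟨h1, h2, h3⟩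
      by_cases hj : j = numAscents x + 2
      · exact Or.inl hj
      · refine Or.inr ⟨⟨h1, by omega, fun hf => h3 (Or.inl hf)⟩, ?_⟩
        by_contra hlt
        exact h3 (Or.inr ⟨d, h1, by omega, h.rep⟩)
    · rintro (rfl | ⟨⟨h1, h2, h3⟩, h4⟩)
      · refine ⟨by omega, by omega, ?_⟩
        rintro (hf | ⟨a, g1, g2, g3⟩)
        · have := InvZ.forb_lt h.bound hf
          omega
        · omega
      · refine ⟨h1, by omega, ?_⟩
        rintro (hf | ⟨a, g1, g2, g3⟩)
        · exact h3 hf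
        · omega
  refine ⟨⟨?_, ?_, ?_, ?_, ?_⟩, ?_, ?_⟩
  · intro j hj
    rw [hasc]
    rcases List.mem_append.1 hj with hj | hj
    · have := h.bound j hj
      omega
    · simp at hj
      omega
  · intro j hj
    exact List.mem_append_left _ (h.low j hj)
  · intro j hj hs
    rcases (rep_snoc _ _ _).1 hs with hs | hs
    · exact h.norep j (by omega) hs
    · omega
  · exact (rep_snoc _ _ _).2 (Or.inl h.rep)
  · rw [hU, Finset.card_insert_of_notMem]
    intro hm
    have := (mem_upper _ _ _).1 (Finset.mem_filter.1 hm).1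
    omega
  · rw [hU]
    exact Finset.mem_insert_of_mem (Finset.mem_filter.2 ⟨hc, le_rfl⟩)
  · intro j hj
    rw [hU] at hj
    rcases Finset.mem_insert.1 hj with rfl | hj
    · omega
    · exact (Finset.mem_filter.1 hj).2

/-- Repeating the last letter. -/
theorem InvZ.append_same {l : List ℕ} {e d k : ℕ} (h : InvZ (l ++ [e]) d k)
    (hc : e ∈ upper (l ++ [e]) d) (hmin : ∀ j ∈ upper (l ++ [e]) d, e ≤ j) :
    InvZ (l ++ [e] ++ [e]) d k ∧ e ∈ upper (l ++ [e] ++ [e]) d ∧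
      ∀ j ∈ upper (l ++ [e] ++ [e]) d, e ≤ j := by
  have hasc : numAscents (l ++ [e] ++ [e]) = numAscents (l ++ [e]) := by
    rw [numAscents_snoc, if_neg (by omega), add_zero]
  have hex : e ∈ l ++ [e] := by simp
  set x := l ++ [e] with hx
  have hc' := (mem_upper _ _ _).1 hc
  have hU : upper (x ++ [e]) d = upper x d := by
    ext j
    constructor
    · simp only [mem_upper, hasc, forb_snoc]
      rintro ⟨h1, h2, h3⟩
      exact ⟨h1, by omega, fun hf => h3 (Or.inl hf)⟩
    · intro hj
      have := hmin j hj
      revert hj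
      simp only [mem_upper, hasc, forb_snoc]
      rintro ⟨h1, h2, h3⟩
      refine ⟨h1, by omega, ?_⟩
      rintro (hf | ⟨a, g1, g2, g3⟩)
      · exact h3 hf
      · omega
  rw [hU]
  refine ⟨⟨?_, ?_, ?_, ?_, ?_⟩, hc, hmin⟩
  · intro j hj
    rw [hasc]
    rcases List.mem_append.1 hj with hj | hj
    · exact h.bound j hj
    · simp at hj
      subst hj
      exact h.bound _ hex
  · intro j hj
    exact List.mem_append_left _ (h.low j hj)
  · intro j hj hs
    rcases (rep_snoc _ _ _).1 hs with hs | hs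
    · exact h.norep j (by omega) hs
    · omega
  · exact (rep_snoc _ _ _).2 (Or.inl h.rep)
  · rw [hU]
    exact h.card

theorem sum_Icc_shift (f : ℕ → ℕ) (k : ℕ) :
    ∑ r ∈ Finset.Icc 1 k, f (r + 1) = ∑ r ∈ Finset.Icc 2 (k + 1), f r := by
  induction k with
  | zero => simp
  | succ k ih =>
    rw [Finset.sum_Icc_succ_top (by omega), Finset.sum_Icc_succ_top (by omega), ih]

theorem cnt_Z (m : ℕ) : ∀ (l : List ℕ) (e d k : ℕ), InvZ (l ++ [e]) d k →
    (e = d → treeCnt chZ m (l ++ [e]) = zp m true d k) ∧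
    (e ∈ upper (l ++ [e]) d → (∀ j ∈ upper (l ++ [e]) d, e ≤ j) →
      treeCnt chZ m (l ++ [e]) = zp m false d k) := by
  induction m with
  | zero => intro l e d k h; simp [treeCnt, zp]
  | succ m ih =>
    intro l e d k h
    have hlow : d ≤ e → ∑ c ∈ allowed (l ++ [e]) with ¬ d < c, treeCnt chZ m (l ++ [e] ++ [c])
        = ∑ i ∈ Finset.range (d + 1), zp m true i (d + k - i) := by
      intro he
      rw [h.allowed_low]
      apply Finset.sum_congr rfl
      intro i hi
      simp at hi
      exact (ih _ _ _ _ (h.append_low he (by omega))).1 rfl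
    have hhigh : ∀ c ∈ upper (l ++ [e]) d, e < c → treeCnt chZ m (l ++ [e] ++ [c]) =
        zp m false d (((upper (l ++ [e]) d).filter (fun j => c ≤ j)).card + 1) := by
      intro c hc hec
      obtain ⟨h1, h2, h3⟩ := h.append_high hc hec
      exact (ih _ _ _ _ h1).2 h2 h3
    have hsplit := Finset.sum_filter_add_sum_filter_not (allowed (l ++ [e])) (fun c => d < c)
      (fun c => treeCnt chZ m (l ++ [e] ++ [c]))
    have hrank := sum_rank (upper (l ++ [e]) d) (fun r => zp m false d (r + 1))
    rw [h.card, sum_Icc_shift] at hrank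
    constructor
    · intro he
      rw [treeCnt_chZ, ← hsplit, hlow he.ge, zp, add_comm]
      congr 1
      simp only [if_true]
      rw [← hrank]
      apply Finset.sum_congr rfl
      intro c hc
      exact hhigh c hc (by have := (mem_upper _ _ _).1 hc; omega)
    · intro he hmin
      have he' := (mem_upper _ _ _).1 he
      rw [treeCnt_chZ, ← hsplit, hlow he'.1.le, zp, add_comm]
      congr 1
      have hk : 1 ≤ k := by
        rw [← h.card]
        exact Finset.card_pos.2 ⟨e, he⟩
      change ∑ c ∈ upper (l ++ [e]) d, treeCnt chZ m (l ++ [e] ++ [c]) = _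
      rw [Finset.sum_Icc_succ_top (by omega)] at hrank
      rw [← Finset.add_sum_erase _ _ he] at hrank ⊢
      have e1 : ((upper (l ++ [e]) d).filter (fun j => e ≤ j)).card = k := by
        rw [Finset.filter_true_of_mem hmin, h.card]
      rw [e1] at hrank
      obtain ⟨g1, g2, g3⟩ := h.append_same he hmin
      rw [(ih _ _ _ _ g1).2 g2 g3]
      have e2 : ∑ c ∈ (upper (l ++ [e]) d).erase e, treeCnt chZ m (l ++ [e] ++ [c]) =
          ∑ c ∈ (upper (l ++ [e]) d).erase e,
            zp m false d (((upper (l ++ [e]) d).filter (fun j => c ≤ j)).card + 1) := by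
        apply Finset.sum_congr rfl
        intro c hc
        rw [Finset.mem_erase] at hc
        have := hmin c hc.2
        exact hhigh c hc.2 (by omega)
      rw [e2]
      simp
      omega

theorem cnt_I (m : ℕ) : ∀ (l : List ℕ) (d : ℕ), numAscents (l ++ [d]) = d →
    (∀ c ∈ l ++ [d], c ≤ d) → (∀ c ≤ d, c ∈ l ++ [d]) → (∀ a, ¬ [a, a].Sublist (l ++ [d])) →
    treeCnt chZ m (l ++ [d]) = zi m d := by
  induction m with
  | zero => intros; simp [treeCnt, zi]
  | succ m ih =>
    intro l d ha hle hlow hrep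
    have hforb : ∀ c, ¬ Forb (l ++ [d]) c := by
      rintro c ⟨a, b, h1, h2, h3⟩
      exact hrep a (List.Sublist.trans (by simp) h3)
    have hall : allowed (l ++ [d]) = Finset.range (d + 1 + 1) := by
      ext c
      rw [mem_allowed, ha, Finset.mem_range]
      simp only [hforb, not_false_eq_true, and_true]
      omega
    rw [treeCnt_chZ, hall, Finset.sum_range_succ, zi, add_comm]
    congr 1
    · apply ih
      · rw [numAscents_snoc, if_pos (by omega), ha]
      · intro c hc
        rcases List.mem_append.1 hc with hc | hc
        · have := hle c hc
          omega
        · simp at hc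
          omega
      · intro c hc
        rcases Nat.lt_or_ge d c with h | h
        · have : c = d + 1 := by omega
          subst this
          simp
        · exact List.mem_append_left _ (hlow c h)
      · intro a h
        rcases (rep_snoc _ _ _).1 h with h | ⟨rfl, h⟩
        · exact hrep a h
        · have := hle _ h
          omega
    · apply Finset.sum_congr rfl
      intro i hi
      simp at hi
      have hasc : numAscents (l ++ [d] ++ [i]) = d := by
        rw [numAscents_snoc, if_neg (by omega), ha, add_zero]
      refine (cnt_Z m (l ++ [d]) i i (d + 1 - i) ⟨?_, ?_, ?_, ?_, ?_⟩).1 rfl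
      · intro c hc
        rw [hasc]
        rcases List.mem_append.1 hc with hc | hc
        · exact hle c hc
        · simp at hc
          omega
      · intro j hj
        exact List.mem_append_left _ (hlow j (by omega))
      · intro j hj hs
        rcases (rep_snoc _ _ _).1 hs with hs | hs
        · exact hrep j hs
        · omega
      · exact (rep_snoc _ _ _).2 (Or.inr ⟨rfl, hlow i (by omega)⟩)
      · have : upper (l ++ [d] ++ [i]) i = Finset.Ioc i (d + 1) := by
          ext c
          simp only [mem_upper, hasc, forb_snoc, Finset.mem_Ioc]
          constructor
          · rintro ⟨h1, h2, _⟩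
            exact ⟨h1, h2⟩
          · rintro ⟨h1, h2⟩
            refine ⟨h1, h2, ?_⟩
            rintro (h | ⟨a, _, _, h⟩)
            · exact hforb c ((forb_snoc _ _ _).2 h)
            · exact hrep _ h
        rw [this, Nat.card_Ioc]

theorem mem_AvSet_0021 (n : ℕ) (x : List ℕ) : x ∈ AvSet [[0, 0, 2, 1]] n ↔
    x.length = n ∧ IsAscentSeq x ∧ ∀ a c b, a < c → c < b → ¬ [a, a, b, c].Sublist x := by
  unfold AvSet Avoids
  simp only [Set.mem_ofPred_eq, List.mem_singleton, forall_eq, contains_0021]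
  push Not
  rfl

theorem card_0021 (m : ℕ) : (AvSet [[0, 0, 2, 1]] (m + 1)).ncard = zi m 0 := by
  classical
  rw [← cnt_I m [] 0 (by simp [numAscents_single]) (by simp) (by simp)
    (by intro a h; have := h.length_le; simp at this)]
  apply tree_count chZ List.dropLast ?_ (fun m => AvSet [[0, 0, 2, 1]] (m + 1))
  · ext x
    rw [mem_AvSet_0021]
    constructor
    · rintro ⟨h1, h2, _⟩
      obtain ⟨a, rfl⟩ := List.length_eq_one_iff.1 h1
      rw [isAscentSeq_single] at h2
      simp [h2]
    · intro h
      simp at h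
      subst h
      refine ⟨rfl, (isAscentSeq_single 0).2 rfl, ?_⟩
      intro a c b _ _ h
      have := h.length_le
      simp at this
  · intro m y
    simp only [mem_AvSet_0021, chZ, Finset.mem_image, mem_allowed]
    constructor
    · rintro ⟨h1, h2, h3⟩
      rcases List.eq_nil_or_concat' y with rfl | ⟨x, c, rfl⟩
      · simp at h1
      have hx : x ≠ [] := by
        rintro rfl
        simp at h1
      rw [isAscentSeq_snoc _ _ hx] at h2
      simp at h1
      refine ⟨x, ⟨h1, h2.1, ?_⟩, c, ⟨h2.2, ?_⟩, rfl⟩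
      · intro a c' b g1 g2 g3
        exact h3 a c' b g1 g2 (g3.trans (by simp))
      · rintro ⟨a, b, g1, g2, g3⟩
        exact h3 a c b g1 g2 ((sub_snoc [a, a, b] x c c).2 (Or.inr ⟨rfl, g3⟩))
    · rintro ⟨x, ⟨h1, h2, h3⟩, c, ⟨h4, h5⟩, rfl⟩
      have hx : x ≠ [] := by
        rintro rfl
        simp at h1
      refine ⟨by simp [h1], (isAscentSeq_snoc _ _ hx).2 ⟨h2, h4⟩, ?_⟩
      intro a c' b g1 g2 g3
      rcases (sub_snoc [a, a, b] x c' c).1 g3 with g | ⟨rfl, g⟩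
      · exact h3 a c' b g1 g2 g
      · exact h5 ⟨a, b, g1, g2, g⟩
  · intro x y h
    rw [chZ, Finset.mem_image] at h
    obtain ⟨c, _, rfl⟩ := h
    simp

/-! ## Restricted growth functions and 1012 -/

/-- Restricted growth functions. -/
def RGF (x : List ℕ) : Prop := ∀ p c s, x = p ++ c :: s → ∀ v < c, v ∈ p

/-- Avoidance of 1012 in terms of sublists. -/
def Av12 (x : List ℕ) : Prop := ∀ u v w, u < v → v < w → ¬ [v, u, v, w].Sublist x

theorem RGF_snoc (x : List ℕ) (c : ℕ) : RGF (x ++ [c]) ↔ RGF x ∧ ∀ v < c, v ∈ x := by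
  constructor
  · intro h
    refine ⟨?_, h x c [] rfl⟩
    rintro p d s rfl
    exact h p d (s ++ [c]) (by simp)
  · rintro ⟨h1, h2⟩ p d s h
    rcases List.eq_nil_or_concat' s with rfl | ⟨s', e, rfl⟩
    · obtain ⟨rfl, h4⟩ := List.append_inj' h rfl
      simp at h4
      subst h4
      exact h2
    · rw [show p ++ d :: (s' ++ [e]) = (p ++ d :: s') ++ [e] by simp] at h
      obtain ⟨rfl, _⟩ := List.append_inj' h rfl
      exact h1 p d s' rfl

theorem RGF.down {x : List ℕ} (h : RGF x) {v w : ℕ} (hw : w ∈ x) (hv : v < w) : v ∈ x := by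
  obtain ⟨p, s, rfl⟩ := List.append_of_mem hw
  exact List.mem_append_left _ (h p w s rfl v hv)

theorem asc_le_card (x : List ℕ) (hne : x ≠ []) (h : ∀ u v, u < v → ¬ [v, u, v].Sublist x) :
    numAscents x + 1 ≤ x.toFinset.card := by
  induction x using List.reverseRecOn with
  | nil => exact absurd rfl hne
  | append_singleton x c ih =>
    rcases List.eq_nil_or_concat' x with rfl | ⟨l, b, rfl⟩
    · simp [numAscents_single]
    · have ih' := ih (by simp) (fun u v huv hs => h u v huv (hs.trans (by simp)))
      rw [numAscents_snoc]
      by_cases hbc : b < c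
      · rw [if_pos hbc]
        have hc : c ∉ l ++ [b] := by
          intro hc
          have hc' : c ∈ l := by
            rcases List.mem_append.1 hc with hc | hc
            · exact hc
            · simp at hc
              omega
          apply h b c hbc
          rw [show [c, b, c] = [c] ++ [b] ++ [c] by rfl]
          exact (List.Sublist.append (List.singleton_sublist.2 hc') (List.Sublist.refl _)).append
            (List.Sublist.refl _)
        rw [List.toFinset_append, Finset.union_comm,
          show [c].toFinset ∪ (l ++ [b]).toFinset = insert c (l ++ [b]).toFinset by
            ext; simp; tauto, Finset.card_insert_of_notMem (by rw [List.mem_toFinset]; exact hc)]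
        omega
      · rw [if_neg hbc]
        refine ih'.trans (Finset.card_le_card ?_)
        rw [List.toFinset_append (l := l ++ [b])]
        exact Finset.subset_union_left

theorem card_le_asc (x : List ℕ) (hne : x ≠ []) (h : RGF x) :
    x.toFinset.card ≤ numAscents x + 1 := by
  induction x using List.reverseRecOn with
  | nil => exact absurd rfl hne
  | append_singleton x c ih =>
    rcases List.eq_nil_or_concat' x with rfl | ⟨l, b, rfl⟩
    · simp [numAscents_single]
    · rw [RGF_snoc] at h
      have ih' := ih (by simp) h.1
      rw [numAscents_snoc, List.toFinset_append, Finset.union_comm,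
          show [c].toFinset ∪ (l ++ [b]).toFinset = insert c (l ++ [b]).toFinset by
            ext; simp; tauto]
      by_cases hc : c ∈ l ++ [b]
      · rw [Finset.insert_eq_of_mem (by rw [List.mem_toFinset]; exact hc)]
        omega
      · rw [Finset.card_insert_of_notMem (by rw [List.mem_toFinset]; exact hc)]
        have hb : b ∈ l ++ [b] := by simp
        have : b < c := by
          by_contra hlt
          rcases Nat.lt_or_ge c b with g | g
          · exact hc (h.1.down hb g)
          · have : b = c := by omega
            exact hc (this ▸ hb)
        rw [if_pos this]
        omega

theorem ascent_iff_RGF (x : List ℕ) (hne : x ≠ []) (h : Av12 x) : IsAscentSeq x ↔ RGF x := by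
  induction x using List.reverseRecOn with
  | nil => exact absurd rfl hne
  | append_singleton x c ih =>
    by_cases hx : x = []
    · subst hx
      rw [List.nil_append, isAscentSeq_single]
      constructor
      · rintro rfl
        intro p d s hp v hv
        have : p = [] := by
          cases p with
          | nil => rfl
          | cons a p => simp at hp
        subst this
        simp at hp
        omega
      · intro hr
        by_contra h0
        have := hr [] c [] rfl 0 (by omega)
        simp at this
    · rw [isAscentSeq_snoc _ _ hx, RGF_snoc,
        ih hx (fun u v w h1 h2 hs => h u v w h1 h2 (hs.trans (by simp)))]
      apply and_congr_right
      intro hr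
      constructor
      · intro hc v hv
        by_cases h101 : ∀ u v, u < v → ¬ [v, u, v].Sublist x
        · have hcard := asc_le_card x hx h101
          by_contra hvx
          have hsub : x.toFinset ⊆ Finset.range v := by
            intro w hw
            simp at hw ⊢
            by_contra hlt
            rcases Nat.lt_or_ge v w with g | g
            · exact hvx (hr.down hw g)
            · have : w = v := by omega
              exact hvx (this ▸ hw)
          have := Finset.card_le_card hsub
          simp at this
          omega
        · push Not at h101
          obtain ⟨u, w, h1, h2⟩ := h101
          have hcw : c ≤ w := by
            by_contra hlt
            exact h u w c h1 (by omega) ((sub_snoc [w, u, w] x c c).2 (Or.inr ⟨rfl, h2⟩))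
          exact hr.down (h2.subset (by simp)) (by omega : v < w)
      · intro hv
        have h1 := card_le_asc x hx hr
        have h2 : Finset.range c ⊆ x.toFinset := by
          intro v hv'
          simpa using hv v (by simpa using hv')
        have := Finset.card_le_card h2
        simp at this
        omega

theorem mem_AvSet_1012 (m : ℕ) (x : List ℕ) : x ∈ AvSet [[1, 0, 1, 2]] (m + 1) ↔
    x.length = m + 1 ∧ RGF x ∧ Av12 x := by
  have : x ∈ AvSet [[1, 0, 1, 2]] (m + 1) ↔ x.length = m + 1 ∧ IsAscentSeq x ∧ Av12 x := by
    unfold AvSet Avoids Av12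
    simp only [Set.mem_ofPred_eq, List.mem_singleton, forall_eq, contains_1012]
    push Not
    rfl
  rw [this]
  constructor
  · rintro ⟨h1, h2, h3⟩
    exact ⟨h1, (ascent_iff_RGF x (by rintro rfl; simp at h1) h3).1 h2, h3⟩
  · rintro ⟨h1, h2, h3⟩
    exact ⟨h1, (ascent_iff_RGF x (by rintro rfl; simp at h1) h3).2 h2, h3⟩

/-! ## The tree of 1012-avoiders -/

/-- A zero may be inserted between `p` and `s`. -/
def Good (p s : List ℕ) : Prop := ∀ v ∈ p, ∀ w, [v, w].Sublist s → w ≤ v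

open Classical in
/-- The good gaps. -/
noncomputable def gaps (x : List ℕ) : Finset ℕ :=
  (Finset.range (x.length + 1)).filter (fun i => Good (x.take i) (x.drop i))

/-- The gaps where a zero may be inserted to the right of all zeros. -/
noncomputable def cg (x : List ℕ) : Finset ℕ :=
  (gaps x).filter (fun i => 1 ≤ i ∧ 0 ∉ x.drop i)

/-- Insert a zero. -/
def ins (x : List ℕ) (i : ℕ) : List ℕ := x.take i ++ 0 :: x.drop i

/-- Add a new level. -/
def nw (x : List ℕ) : List ℕ := 0 :: x.map (· + 1)

open Classical in
/-- Children in the 1012 tree. -/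
noncomputable def chN (x : List ℕ) : Finset (List ℕ) := insert (nw x) ((cg x).image (ins x))

/-- Parent in the 1012 tree. -/
def parN (y : List ℕ) : List ℕ :=
  if 0 ∈ y.tail then (y.reverse.erase 0).reverse else y.tail.map (· - 1)

theorem mem_gaps (x : List ℕ) (i : ℕ) :
    i ∈ gaps x ↔ ∃ p s, x = p ++ s ∧ p.length = i ∧ Good p s := by
  unfold gaps
  simp only [Finset.mem_filter, Finset.mem_range]
  constructor
  · rintro ⟨h1, h2⟩
    exact ⟨_, _, (List.take_append_drop i x).symm, by simp; omega, h2⟩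
  · rintro ⟨p, s, rfl, rfl, h⟩
    refine ⟨by simp, by simpa using h⟩

theorem mem_cg (x : List ℕ) (i : ℕ) :
    i ∈ cg x ↔ ∃ p s, x = p ++ s ∧ p.length = i ∧ Good p s ∧ p ≠ [] ∧ 0 ∉ s := by
  unfold cg
  rw [Finset.mem_filter, mem_gaps]
  constructor
  · rintro ⟨⟨p, s, rfl, rfl, h⟩, h1, h2⟩
    refine ⟨p, s, rfl, rfl, h, ?_, by simpa using h2⟩
    rintro rfl
    simp at h1
  · rintro ⟨p, s, rfl, rfl, h, h1, h2⟩
    exact ⟨⟨p, s, rfl, rfl, h⟩, List.length_pos_iff.2 h1, by simpa using h2⟩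

theorem ins_append (p s : List ℕ) : ins (p ++ s) p.length = p ++ 0 :: s := by
  simp [ins]

theorem parN_nw (x : List ℕ) : parN (nw x) = x := by
  simp [parN, nw, Function.comp_def]

theorem parN_ins (p s : List ℕ) (hp : p ≠ []) (hs : 0 ∉ s) : parN (p ++ 0 :: s) = p ++ s := by
  cases p with
  | nil => exact absurd rfl hp
  | cons a p =>
    have : 0 ∈ (a :: p ++ 0 :: s).tail := by simp
    rw [parN, if_pos this, List.reverse_append, List.reverse_cons, List.append_assoc,
      List.erase_append_right _ (by simpa using hs)]
    simp

theorem parN_ch (x y : List ℕ) (h : y ∈ chN x) : parN y = x := by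
  rw [chN, Finset.mem_insert, Finset.mem_image] at h
  rcases h with rfl | ⟨i, hi, rfl⟩
  · exact parN_nw x
  · obtain ⟨p, s, rfl, rfl, _, h1, h2⟩ := (mem_cg _ _).1 hi
    rw [ins_append, parN_ins p s h1 h2]

theorem append_zero_inj {a b a' b' : List ℕ} (h : a ++ 0 :: b = a' ++ 0 :: b') (hb : 0 ∉ b)
    (hb' : 0 ∉ b') : a = a' := by
  rcases List.append_eq_append_iff.1 h with ⟨c, h1, h2⟩ | ⟨c, h1, h2⟩
  · cases c with
    | nil => simpa using h1.symm
    | cons d c =>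
      simp at h2
      exact absurd (by rw [h2.2]; simp) hb
  · cases c with
    | nil => simpa using h1
    | cons d c =>
      simp at h2
      exact absurd (by rw [h2.2]; simp) hb'

theorem treeCnt_chN (m : ℕ) (x : List ℕ) : treeCnt chN (m + 1) x =
    treeCnt chN m (nw x) + ∑ i ∈ cg x, treeCnt chN m (ins x i) := by
  classical
  rw [treeCnt, chN, Finset.sum_insert, Finset.sum_image]
  · intro i hi j hj hij
    obtain ⟨p, s, rfl, rfl, _, h1, h2⟩ := (mem_cg _ _).1 hi
    obtain ⟨q, t, h0, rfl, _, h3, h4⟩ := (mem_cg _ _).1 hj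
    rw [ins_append, h0, ins_append] at hij
    rw [append_zero_inj hij h2 h4]
  · rw [Finset.mem_image]
    rintro ⟨i, hi, h⟩
    obtain ⟨p, s, rfl, rfl, _, h1, h2⟩ := (mem_cg _ _).1 hi
    rw [ins_append] at h
    have h3 : 0 ∈ (p ++ 0 :: s).tail := by
      cases p with
      | nil => exact absurd rfl h1
      | cons a p => simp
    rw [h] at h3
    simp [nw] at h3

theorem good_map (p s : List ℕ) :
    Good (0 :: p.map (· + 1)) (s.map (· + 1)) ↔ Good p s := by
  constructor
  · intro h v hv w hs
    have := h (v + 1) (by simp [hv]) (w + 1) (by simpa using hs.map (· + 1))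
    omega
  · intro h v hv w hs
    obtain ⟨l, hl, he⟩ := List.sublist_map_iff.1 hs
    match l, he with
    | [a, b], he =>
      simp at he
      obtain ⟨rfl, rfl⟩ := he
      simp at hv
      have := h a hv b hl
      omega

theorem card_cg_nw (x : List ℕ) : (cg (nw x)).card = (gaps x).card := by
  have : cg (nw x) = (gaps x).image (· + 1) := by
    ext j
    rw [mem_cg, Finset.mem_image]
    constructor
    · rintro ⟨p, s, h, rfl, h1, h2, h3⟩
      cases p with
      | nil => exact absurd rfl h2
      | cons a p =>
        simp only [nw, List.cons_append, List.cons.injEq] at h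
        obtain ⟨rfl, h⟩ := h
        obtain ⟨p', s', rfl, rfl, rfl⟩ := List.map_eq_append_iff.1 h
        refine ⟨p'.length, (mem_gaps _ _).2 ⟨p', s', rfl, rfl, (good_map _ _).1 h1⟩, by simp⟩
    · rintro ⟨i, hi, rfl⟩
      obtain ⟨p, s, rfl, rfl, h⟩ := (mem_gaps _ _).1 hi
      exact ⟨0 :: p.map (· + 1), s.map (· + 1), by simp [nw], by simp, (good_map _ _).2 h,
        by simp, by simp⟩
  rw [this, Finset.card_image_of_injective _ (add_left_injective 1)]

theorem card_gaps_A (l : List ℕ) (e : ℕ) (h0 : (l ++ [e + 1]).head? = some 0) :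
    (gaps (l ++ [e + 1])).card = (cg (l ++ [e + 1])).card + 1 := by
  have : gaps (l ++ [e + 1]) = insert 0 (cg (l ++ [e + 1])) := by
    ext i
    rw [Finset.mem_insert, mem_gaps, mem_cg]
    constructor
    · rintro ⟨p, s, h, rfl, h1⟩
      cases p with
      | nil => simp
      | cons a p =>
        right
        refine ⟨a :: p, s, h, rfl, h1, by simp, ?_⟩
        intro hs
        have ha : a = 0 := by
          rw [h] at h0
          simpa using h0
        subst ha
        rcases List.eq_nil_or_concat' s with rfl | ⟨s', f, rfl⟩
        · simp at hs
        · rw [← List.append_assoc] at h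
          obtain ⟨_, h3⟩ := List.append_inj' h rfl
          simp at h3
          subst h3
          have hs' : 0 ∈ s' := by simpa using hs
          have := h1 0 (by simp) (e + 1)
            ((sub_snoc [0] s' (e + 1) (e + 1)).2 (Or.inr ⟨rfl, List.singleton_sublist.2 hs'⟩))
          omega
    · rintro (rfl | ⟨p, s, h, h1, h2, _⟩)
      · exact ⟨[], _, rfl, rfl, by intro v hv; simp at hv⟩
      · exact ⟨p, s, h, h1, h2⟩
  rw [this, Finset.card_insert_of_notMem]
  intro h
  obtain ⟨p, s, _, h1, _, h2, _⟩ := (mem_cg _ _).1 h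
  exact h2 (List.length_eq_zero_iff.1 h1)

theorem card_cg_ins (a b : List ℕ) (ha : a ≠ []) :
    (cg (a ++ 0 :: b)).card = ((cg (a ++ b)).filter (fun j => a.length ≤ j)).card := by
  have hgood : ∀ c s : List ℕ, 0 ∉ s → (Good (a ++ 0 :: c) s ↔ Good (a ++ c) s) := by
    intro c s hs
    constructor
    · intro h v hv
      apply h v
      simp at hv ⊢
      tauto
    · intro h v hv w hw
      rcases Nat.eq_zero_or_pos v with rfl | hv0
      · exact absurd (hw.subset (by simp)) hs
      · refine h v ?_ w hw
        simp at hv ⊢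
        rcases hv with hv | hv | hv
        · exact Or.inl hv
        · omega
        · exact Or.inr hv
  have : cg (a ++ 0 :: b) = ((cg (a ++ b)).filter (fun j => a.length ≤ j)).image (· + 1) := by
    ext j
    rw [mem_cg, Finset.mem_image]
    constructor
    · rintro ⟨p, s, h, rfl, h1, h2, h3⟩
      rcases List.append_eq_append_iff.1 h with ⟨c, rfl, h5⟩ | ⟨c, _, rfl⟩
      · cases c with
        | nil =>
          simp at h5
          subst h5
          simp at h3
        | cons d c =>
          simp at h5
          obtain ⟨rfl, rfl⟩ := h5
          refine ⟨(a ++ c).length, ?_, by simp; omega⟩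
          rw [Finset.mem_filter, mem_cg]
          exact ⟨⟨a ++ c, s, by simp, rfl, (hgood c s h3).1 h1, by simp [ha], h3⟩, by simp⟩
      · simp at h3
    · rintro ⟨i, hi, rfl⟩
      rw [Finset.mem_filter, mem_cg] at hi
      obtain ⟨⟨p, s, h, rfl, h1, h2, h3⟩, h4⟩ := hi
      obtain ⟨c, rfl, rfl⟩ : ∃ c, p = a ++ c ∧ b = c ++ s := by
        rcases List.append_eq_append_iff.1 h with ⟨c, h5, h6⟩ | ⟨c, rfl, h6⟩
        · exact ⟨c, h5, h6⟩
        · simp at h4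
          subst h4
          exact ⟨[], by simp, by simpa using h6.symm⟩
      exact ⟨a ++ 0 :: c, s, by simp, by simp; omega, (hgood c s h3).2 h1, by simp, h3⟩
  rw [this, Finset.card_image_of_injective _ (add_left_injective 1)]

theorem card_gaps_snoc (x : List ℕ) : (gaps (x ++ [0])).card = (gaps x).card + 1 := by
  have : gaps (x ++ [0]) = insert (x.length + 1) (gaps x) := by
    ext i
    rw [Finset.mem_insert, mem_gaps, mem_gaps]
    constructor
    · rintro ⟨p, s, h, rfl, h1⟩
      rcases List.eq_nil_or_concat' s with rfl | ⟨s', f, rfl⟩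
      · left
        have := congrArg List.length h
        simp at this
        omega
      · right
        rw [← List.append_assoc] at h
        obtain ⟨h2, _⟩ := List.append_inj' h rfl
        refine ⟨p, s', h2, rfl, ?_⟩
        intro v hv w hw
        exact h1 v hv w (hw.trans (by simp))
    · rintro (rfl | ⟨p, s, rfl, rfl, h⟩)
      · refine ⟨x ++ [0], [], by simp, by simp, ?_⟩
        intro v _ w hw
        simp at hw
      · refine ⟨p, s ++ [0], by simp, rfl, ?_⟩
        intro v hv w hw
        rcases (sub_snoc [v] s w 0).1 hw with hw | ⟨rfl, _⟩
        · exact h v hv w hw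
        · omega
  rw [this, Finset.card_insert_of_notMem]
  intro h
  obtain ⟨p, s, h1, h2, _⟩ := (mem_gaps _ _).1 h
  have := congrArg List.length h1
  simp at this
  omega

theorem length_mem_cg (x : List ℕ) (hx : x ≠ []) : x.length ∈ cg x := by
  rw [mem_cg]
  refine ⟨x, [], by simp, rfl, ?_, hx, by simp⟩
  intro v _ w hw
  simp at hw

theorem cg_le_length (x : List ℕ) {i : ℕ} (hi : i ∈ cg x) : i ≤ x.length := by
  obtain ⟨p, s, rfl, rfl, _⟩ := (mem_cg _ _).1 hi
  simp

theorem cg_B (l : List ℕ) : cg (l ++ [0]) = {(l ++ [0]).length} := by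
  ext i
  rw [Finset.mem_singleton]
  constructor
  · intro hi
    obtain ⟨p, s, h, rfl, _, _, h2⟩ := (mem_cg _ _).1 hi
    rcases List.eq_nil_or_concat' s with rfl | ⟨s', f, rfl⟩
    · rw [h]
      simp
    · rw [← List.append_assoc] at h
      obtain ⟨_, h3⟩ := List.append_inj' h rfl
      simp at h3
      subst h3
      simp at h2
  · rintro rfl
    exact length_mem_cg _ (by simp)

theorem ins_length (x : List ℕ) : ins x x.length = x ++ [0] := by
  simp [ins]

theorem cnt_N (m : ℕ) : ∀ (l : List ℕ) (e k : ℕ), (l ++ [e]).head? = some 0 →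
    (gaps (l ++ [e])).card = k + 2 →
    treeCnt chN m (l ++ [e]) = ab m (decide (e ≠ 0)) k := by
  induction m with
  | zero => intros; simp [treeCnt, ab]
  | succ m ih =>
    intro l e k h0 hk
    have hnw : treeCnt chN m (nw (l ++ [e])) = ab m true (k + 1) := by
      have e1 : nw (l ++ [e]) = (0 :: l.map (· + 1)) ++ [e + 1] := by simp [nw]
      have h1 := card_gaps_A (0 :: l.map (· + 1)) e (by simp)
      rw [← e1, card_cg_nw, hk] at h1
      rw [e1] at h1 ⊢
      rw [ih _ _ (k + 1) (by simp) h1]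
      simp
    have hend : treeCnt chN m (ins (l ++ [e]) (l ++ [e]).length) = ab m false (k + 1) := by
      rw [ins_length, ih (l ++ [e]) 0 (k + 1) _ (by rw [card_gaps_snoc, hk])]
      · simp
      · rw [List.head?_append_of_ne_nil _ (by simp)]
        exact h0
    rw [treeCnt_chN, hnw]
    cases e with
    | zero =>
      rw [cg_B, Finset.sum_singleton, hend, ab]
      simp
    | succ e =>
      have hcg := card_gaps_A l e h0
      rw [hk] at hcg
      have hmem := length_mem_cg (l ++ [e + 1]) (by simp)
      have hrank := sum_rank (cg (l ++ [e + 1])) (fun r => ab m true (r - 1))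
      rw [← Finset.add_sum_erase _ _ hmem] at hrank ⊢
      rw [hend, ab]
      have r1 : ((cg (l ++ [e + 1])).filter (fun j => (l ++ [e + 1]).length ≤ j)).card = 1 := by
        rw [Finset.card_eq_one]
        refine ⟨(l ++ [e + 1]).length, ?_⟩
        ext j
        rw [Finset.mem_filter, Finset.mem_singleton]
        constructor
        · rintro ⟨h1, h2⟩
          exact le_antisymm (cg_le_length _ h1) h2
        · rintro rfl
          exact ⟨hmem, le_rfl⟩
      have hcgk : (cg (l ++ [e + 1])).card = k + 1 := by omega
      have r2 : ∑ r ∈ Finset.Icc 1 (k + 1), ab m true (r - 1) =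
          ab m true 0 + ∑ j ∈ Finset.Icc 1 k, ab m true j := by
        clear * -
        induction k with
        | zero => simp
        | succ k ih =>
          rw [Finset.sum_Icc_succ_top (by omega), ih, Finset.sum_Icc_succ_top (by omega)]
          simp
          ring
      rw [hcgk, r2, r1] at hrank
      have r3 : ∑ i ∈ (cg (l ++ [e + 1])).erase (l ++ [e + 1]).length,
          treeCnt chN m (ins (l ++ [e + 1]) i) =
          ∑ i ∈ (cg (l ++ [e + 1])).erase (l ++ [e + 1]).length,
          ab m true (((cg (l ++ [e + 1])).filter (fun j => i ≤ j)).card - 1) := by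
        apply Finset.sum_congr rfl
        intro i hi
        rw [Finset.mem_erase] at hi
        obtain ⟨hne, hi⟩ := hi
        obtain ⟨p, s, h, rfl, h1, h2, h3⟩ := (mem_cg _ _).1 hi
        rcases List.eq_nil_or_concat' s with rfl | ⟨s', f, rfl⟩
        · rw [h] at hne
          simp at hne
        have h' := h
        rw [← List.append_assoc] at h'
        obtain ⟨_, h4⟩ := List.append_inj' h' rfl
        simp at h4
        subst h4
        have hpos : 0 < ((cg (l ++ [e + 1])).filter (fun j => p.length ≤ j)).card :=
          Finset.card_pos.2 ⟨_, Finset.mem_filter.2 ⟨hi, le_rfl⟩⟩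
        rw [h, ins_append]
        rw [h] at hpos h0
        have e2 : p ++ 0 :: (s' ++ [e + 1]) = (p ++ 0 :: s') ++ [e + 1] := by simp
        have hhead : ((p ++ 0 :: s') ++ [e + 1]).head? = some 0 := by
          rw [← e2]
          rw [List.head?_append_of_ne_nil _ h2] at h0 ⊢
          exact h0
        have h5 := card_gaps_A _ _ hhead
        rw [← e2, card_cg_ins _ _ h2] at h5
        rw [e2] at h5 ⊢
        rw [ih _ _ (((cg (p ++ (s' ++ [e + 1]))).filter (fun j => p.length ≤ j)).card - 1) hhead
          (by omega)]
        simp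
      rw [r3]
      rw [if_pos (by simp)]
      simp only [Nat.sub_self] at hrank
      omega

theorem card_1012 (m : ℕ) : (AvSet [[1, 0, 1, 2]] (m + 1)).ncard = ab m false 0 := by
  classical
  have hg : (gaps ([] ++ [0])).card = 0 + 2 := by
    rw [card_gaps_snoc]
    have : gaps [] = {0} := by
      ext i
      rw [mem_gaps, Finset.mem_singleton]
      constructor
      · rintro ⟨p, s, h, rfl, _⟩
        have := congrArg List.length h
        rw [List.length_append, List.length_nil] at this
        omega
      · rintro rfl
        exact ⟨[], [], rfl, rfl, by intro v hv; simp at hv⟩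
    rw [this]
    simp
  have hc := cnt_N m [] 0 0 rfl hg
  simp only [ne_eq, not_true_eq_false, decide_false, List.nil_append] at hc
  rw [← hc]
  apply tree_count chN parN parN_ch (fun m => AvSet [[1, 0, 1, 2]] (m + 1))
  · ext x
    rw [mem_AvSet_1012]
    constructor
    · rintro ⟨h1, h2, _⟩
      obtain ⟨a, rfl⟩ := List.length_eq_one_iff.1 h1
      have := (RGF_snoc [] a).1 h2
      by_contra ha
      have := this.2 0 (by simp at ha; omega)
      simp at this
    · intro h
      simp at h
      subst h
      refine ⟨rfl, ?_, ?_⟩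
      · apply (RGF_snoc [] 0).2
        refine ⟨?_, by simp⟩
        intro p c s h
        simp at h
      · intro a c b _ _ h
        have := h.length_le
        simp at this
  · intro m y
    simp only [mem_AvSet_1012, chN, Finset.mem_insert, Finset.mem_image]
    constructor
    · rintro ⟨h1, h2, h3⟩
      match y, h1 with
      | c :: t, h1 =>
      have hc : c = 0 := by
        by_contra hne
        have := h2 [] c t rfl 0 (by omega)
        simp at this
      subst hc
      by_cases ht : 0 ∈ t
      · -- remove the rightmost zero
        obtain ⟨q, s, rfl, hs⟩ : ∃ q s, t = q ++ 0 :: s ∧ 0 ∉ s := by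
          have : 0 ∈ t.reverse := by simpa using ht
          obtain ⟨as, bs, h4, h5⟩ := List.eq_append_cons_of_mem this
          refine ⟨bs.reverse, as.reverse, ?_, by simpa using h5⟩
          rw [← List.reverse_reverse t, h4]
          simp
        have hy : 0 :: (q ++ 0 :: s) = (0 :: q) ++ 0 :: s := rfl
        rw [hy] at h2 h3 ⊢
        refine ⟨(0 :: q) ++ s, ⟨?_, ?_, ?_⟩, Or.inr ⟨(0 :: q).length, ?_, ins_append _ _⟩⟩
        · simp at h1 ⊢
          omega
        · intro p c s' h v hv
          rcases List.append_eq_append_iff.1 h with ⟨d, rfl, h5⟩ | ⟨d, h5, h6⟩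
          · have := h2 ((0 :: q) ++ 0 :: d) c s' (by rw [h5]; simp) v hv
            simp at this ⊢
            tauto
          · cases d with
            | nil =>
              simp at h6
              have := h2 ((0 :: q) ++ [0]) c s' (by rw [← h6]; simp) v hv
              rw [← List.append_nil p, ← h5]
              simp at this ⊢
              tauto
            | cons f d =>
              simp only [List.cons_append, List.cons.injEq] at h6
              obtain ⟨rfl, rfl⟩ := h6
              exact h2 p c (d ++ 0 :: s) (by rw [h5]; simp) v hv
        · intro u v w h4 h5 h6
          refine h3 u v w h4 h5 (h6.trans ?_)
          exact List.Sublist.append (List.Sublist.refl _) (List.sublist_cons_self _ _)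
        · rw [mem_cg]
          refine ⟨0 :: q, s, rfl, rfl, ?_, by simp, hs⟩
          intro v hv w hw
          by_contra hlt
          have hv0 : 0 < v := by
            rcases Nat.eq_zero_or_pos v with rfl | h
            · exact absurd (hw.subset (by simp)) hs
            · exact h
          apply h3 0 v w hv0 (by omega)
          exact List.Sublist.append (List.singleton_sublist.2 hv) (hw.cons_cons 0)
      · have hy : 0 :: t = nw (t.map (· - 1)) := by
          simp only [nw, List.map_map, List.cons.injEq, true_and]
          symm
          rw [List.map_congr_left (g := id)]
          · simp
          · intro a ha
            have : a ≠ 0 := by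
              rintro rfl
              exact ht ha
            simp
            omega
        refine ⟨t.map (· - 1), ⟨by simpa using h1, ?_, ?_⟩, Or.inl hy⟩
        · intro p c s h v hv
          rw [hy, h] at h2
          have := h2 (0 :: p.map (· + 1)) (c + 1) (s.map (· + 1)) (by simp [nw]) (v + 1) (by omega)
          simpa using this
        · intro u v w h4 h5 h6
          rw [hy] at h3
          apply h3 (u + 1) (v + 1) (w + 1) (by omega) (by omega)
          exact (by simpa using h6.map (· + 1) : [v + 1, u + 1, v + 1, w + 1].Sublist
            ((t.map (· - 1)).map (· + 1))).cons 0
    · rintro ⟨x, ⟨h1, h2, h3⟩, rfl | ⟨i, hi, rfl⟩⟩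
      · refine ⟨by simp [nw, h1], ?_, ?_⟩
        · intro p c s h v hv
          cases p with
          | nil =>
            simp [nw] at h
            omega
          | cons a p =>
            simp only [nw, List.cons_append, List.cons.injEq] at h
            obtain ⟨rfl, h⟩ := h
            obtain ⟨p', s', rfl, rfl, h5⟩ := List.map_eq_append_iff.1 h
            obtain ⟨c', s'', rfl, rfl, rfl⟩ := List.map_eq_cons_iff.1 h5
            cases v with
            | zero => simp
            | succ v =>
              have := h2 p' c' s'' rfl v (by omega)
              simpa using this
        · intro u v w h4 h5 h6
          rw [nw, List.sublist_cons_iff] at h6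
          rcases h6 with h6 | ⟨r, h6, _⟩
          · obtain ⟨l, hl, he⟩ := List.sublist_map_iff.1 h6
            match l, he with
            | [a, b, c, d], he =>
              simp at he
              obtain ⟨rfl, rfl, h7, rfl⟩ := he
              obtain rfl : a = c := by omega
              exact h3 b a d (by omega) (by omega) hl
          · simp at h6
            omega
      · obtain ⟨a, b, rfl, rfl, g1, g2, g3⟩ := (mem_cg _ _).1 hi
        rw [ins_append]
        refine ⟨by simp at h1 ⊢; omega, ?_, ?_⟩
        · intro p c s h v hv
          rcases List.append_eq_append_iff.1 h with ⟨d, rfl, h5⟩ | ⟨d, rfl, h6⟩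
          · cases d with
            | nil =>
              simp at h5
              omega
            | cons f d =>
              simp only [List.cons_append, List.cons.injEq] at h5
              obtain ⟨rfl, rfl⟩ := h5
              have := h2 (a ++ d) c s (by simp) v hv
              simp at this ⊢
              tauto
          · cases d with
            | nil =>
              simp at h6
              omega
            | cons f d =>
              simp only [List.cons_append, List.cons.injEq] at h6
              obtain ⟨rfl, rfl⟩ := h6
              exact h2 p c (d ++ b) (by simp) v hv
        · intro u v w h4 h5 h6
          obtain ⟨l1, l2, h7, h8, h9⟩ := List.sublist_append_iff.1 h6
          rcases List.sublist_cons_iff.1 h9 with h9 | ⟨r, hr, h10⟩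
          · exact h3 u v w h4 h5 (h7 ▸ h8.append h9)
          · subst hr
            match l1, h7 with
            | [], h7 =>
              simp at h7
              omega
            | [p], h7 =>
              simp at h7
              obtain ⟨rfl, _, rfl⟩ := h7
              have := g1 v (by simpa using h8) w h10
              omega
            | [p, q], h7 =>
              simp at h7
              omega
            | [p, q, p'], h7 =>
              simp at h7
              omega
            | p :: q :: p' :: q' :: l, h7 => simp at h7

/-- The patterns 0021 and 1012 are Wilf equivalent for ascent
sequences. -/
theorem wilf_equiv_0021_1012 (n : ℕ) (hn : 1 ≤ n) :
    (AvSet [[0,0,2,1]] n).ncard = (AvSet [[1,0,1,2]] n).ncard := by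
  obtain ⟨m, rfl⟩ : ∃ m, n = m + 1 := ⟨n - 1, by omega⟩
  rw [card_0021, card_1012, zi_eq_ab]
end

section
/- Let a = a₁⋯aₙ ∈ 𝒜_{201,210}(n) and let x ∈ S_a with x < aₙ, and set a* = a₁⋯aₙx ∈ 𝒜_{201,210}(n+1). Then S_{a*} = S_a \ ({i : x < i < aₙ} ∪ {i : 0 ≤ i < x}); that is, S_{a*} consists exactly of those elements i of S_a with i = x or i ≥ aₙ. -/
/-- `S_a`: the set of values `y` that may be appended to `a` so that the
result is an ascent sequence avoiding every pattern in `B`. -/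
def Sset (B : List (List ℕ)) (a : List ℕ) : Set ℕ :=
  {y | IsAscentSeq (a ++ [y]) ∧ ∀ p ∈ B, Avoids (a ++ [y]) p}

def Bad (l : List ℕ) : Prop := ∃ p q r, [p,q,r].Sublist l ∧ q < p ∧ r < p ∧ q ≠ r

theorem avoid_iff (l : List ℕ) :
    (∀ p ∈ ([[2,0,1],[2,1,0]] : List (List ℕ)), Avoids l p) ↔ ¬ Bad l := by
  constructor
  · rintro h ⟨p, q, r, hs, h1, h2, h3⟩
    rcases lt_or_gt_of_ne h3 with h3 | h3
    · refine h [2,0,1] (by simp) ⟨[p,q,r], hs, rfl, ?_⟩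
      intro s t h1 h2
      simp only [List.length_cons, List.length_nil] at h1 h2
      interval_cases s <;> interval_cases t <;> simp <;> omega
    · refine h [2,1,0] (by simp) ⟨[p,q,r], hs, rfl, ?_⟩
      intro s t h1 h2
      simp only [List.length_cons, List.length_nil] at h1 h2
      interval_cases s <;> interval_cases t <;> simp <;> omega
  · rintro h p hp ⟨u, hs, hl, hu⟩
    apply h
    simp only [List.mem_cons, List.not_mem_nil, or_false] at hp
    have hl3 : u.length = 3 := by rcases hp with rfl | rfl <;> simpa using hl
    obtain ⟨a, b, c, rfl⟩ := List.length_eq_three.mp hl3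
    refine ⟨a, b, c, hs, ?_⟩
    rcases hp with rfl | rfl
    all_goals
      have h1 := hu 1 0 (by simp) (by simp)
      have h2 := hu 2 0 (by simp) (by simp)
      have h3 := hu 1 2 (by simp) (by simp)
      simp at h1 h2 h3
      omega

theorem snoc_sub (u l : List ℕ) (w z : ℕ) :
    (u ++ [w]).Sublist (l ++ [z]) ↔ (u ++ [w]).Sublist l ∨ (w = z ∧ u.Sublist l) := by
  rw [← List.reverse_sublist, ← List.reverse_sublist (l₁ := u ++ [w]),
    ← List.reverse_sublist (l₁ := u)]
  simp [List.cons_sublist_cons']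

theorem sub3 (p q r : ℕ) (l : List ℕ) (z : ℕ) :
    [p,q,r].Sublist (l ++ [z]) ↔ [p,q,r].Sublist l ∨ (r = z ∧ [p,q].Sublist l) :=
  snoc_sub [p,q] l r z

theorem sub2 (p q : ℕ) (l : List ℕ) (z : ℕ) :
    [p,q].Sublist (l ++ [z]) ↔ [p,q].Sublist l ∨ (q = z ∧ [p].Sublist l) :=
  snoc_sub [p] l q z

theorem sub1 (p : ℕ) (l : List ℕ) (z : ℕ) :
    [p].Sublist (l ++ [z]) ↔ [p].Sublist l ∨ p = z := by
  simpa using snoc_sub [] l p z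

theorem asc_snoc (b : List ℕ) (m x : ℕ) :
    numAscents (b ++ [m] ++ [x]) = numAscents (b ++ [m]) + if m < x then 1 else 0 := by
  induction b with
  | nil => simp [numAscents, List.filter_cons]; split_ifs <;> rfl
  | cons c b ih =>
    cases b with
    | nil =>
      simp [numAscents, List.filter_cons] at ih ⊢
      split_ifs <;> simp
    | cons d b =>
      simp [numAscents, List.filter_cons] at ih ⊢
      split_ifs at ih ⊢ <;> simp_all

theorem ascSeq_snoc (l : List ℕ) (hl : l ≠ []) (y : ℕ) :
    IsAscentSeq (l ++ [y]) ↔ IsAscentSeq l ∧ y ≤ numAscents l + 1 := by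
  have hpos : 0 < l.length := List.length_pos_iff.mpr hl
  have key : ∀ i, i < l.length → (l ++ [y]).getD i 0 = l.getD i 0 ∧
      (l ++ [y]).take i = l.take i := by
    intro i hi
    exact ⟨List.getD_append _ _ _ _ hi, List.take_append_of_le_length hi.le⟩
  have hhead : (l ++ [y]).head? = l.head? := by
    cases l with
    | nil => exact absurd rfl hl
    | cons c l => rfl
  have hlast : (l ++ [y]).getD l.length 0 = y := by simp
  have htake : (l ++ [y]).take l.length = l := by simp
  unfold IsAscentSeq
  rw [hhead]
  constructor
  · rintro ⟨h0, h⟩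
    refine ⟨⟨h0, fun i hi hil => ?_⟩, ?_⟩
    · have := h i hi (by simp; omega)
      rwa [(key i hil).1, (key i hil).2] at this
    · have := h l.length hpos (by simp)
      rwa [hlast, htake] at this
  · rintro ⟨⟨h0, h⟩, hy⟩
    refine ⟨h0, fun i hi hil => ?_⟩
    rcases Nat.lt_or_ge i l.length with h' | h'
    · rw [(key i h').1, (key i h').2]; exact h i hi h'
    · have : i = l.length := by simp at hil; omega
      subst this
      rwa [hlast, htake]

theorem bad_iff (b : List ℕ) (m x y : ℕ) (hlt : x < m) (hx : ¬ Bad (b ++ [m] ++ [x])) :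
    ¬ Bad (b ++ [m] ++ [x] ++ [y]) ↔ ¬ Bad (b ++ [m] ++ [y]) ∧ (y = x ∨ m ≤ y) := by
  constructor
  · intro h
    refine ⟨?_, ?_⟩
    · rintro ⟨p, q, r, hs, h'⟩
      refine h ⟨p, q, r, hs.trans ?_, h'⟩
      exact List.Sublist.append (List.sublist_append_left _ _) (List.Sublist.refl _)
    · by_contra hc
      refine h ⟨m, x, y, ?_, hlt, by omega, by omega⟩
      have : [m,x,y] = [m] ++ [x] ++ [y] := rfl
      rw [this]
      exact ((List.sublist_append_right b [m]).append (List.Sublist.refl _)).append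
        (List.Sublist.refl _)
  · rintro ⟨hy, hxy⟩ ⟨p, q, r, hs, h1, h2, h3⟩
    rw [sub3] at hs
    rcases hs with hs | ⟨rfl, hs⟩
    · exact hx ⟨p, q, r, hs, h1, h2, h3⟩
    · rw [sub2] at hs
      rcases hs with hs | ⟨rfl, hs⟩
      · exact hy ⟨p, q, r, (sub3 _ _ _ _ _).2 (Or.inr ⟨rfl, hs⟩), h1, h2, h3⟩
      · rw [sub1] at hs
        rcases hs with hs | rfl
        · refine hx ⟨p, m, q, ?_, by omega, h1, by omega⟩
          rw [sub3, sub2]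
          exact Or.inr ⟨rfl, Or.inr ⟨rfl, hs⟩⟩
        · omega

/-- appending `x < aₙ` (a descent) yields
`S_{a*} = S_a \ ({i : x < i < aₙ} ∪ {i : i < x})`. -/
theorem Sset_append_descent (n : ℕ) (hn : 1 ≤ n) (a : List ℕ)
    (ha : a ∈ AvSet [[2,0,1], [2,1,0]] n) (x : ℕ)
    (hx : x ∈ Sset [[2,0,1], [2,1,0]] a) (hlt : x < a.getLastD 0) :
    Sset [[2,0,1], [2,1,0]] (a ++ [x]) =
      Sset [[2,0,1], [2,1,0]] a \
        ({i | x < i ∧ i < a.getLastD 0} ∪ {i | i < x}) := by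
  obtain ⟨hlen, haS, -⟩ := ha
  have hne : a ≠ [] := by rintro rfl; simp at hlen; omega
  obtain ⟨b, m, rfl⟩ : ∃ b m, a = b ++ [m] :=
    ⟨_, _, (List.dropLast_append_getLast hne).symm⟩
  have hm : (b ++ [m]).getLastD 0 = m := by simp
  rw [hm] at hlt ⊢
  obtain ⟨hx1, hx2⟩ := hx
  rw [avoid_iff] at hx2
  ext y
  simp only [Sset, Set.mem_setOf_eq, Set.mem_diff, Set.mem_union]
  rw [avoid_iff, avoid_iff, bad_iff b m x y hlt hx2, ascSeq_snoc _ (by simp) y,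
    ascSeq_snoc (b ++ [m]) hne y, asc_snoc, if_neg (by omega), Nat.add_zero]
  have : (y = x ∨ m ≤ y) ↔ ¬ ((x < y ∧ y < m) ∨ y < x) := by omega
  rw [this]
  tauto
end

section
/- If a = a₁⋯aₙ is an ascent sequence of length n ≥ 1 avoiding the pattern 0021, then the sequence a₁⋯aₙaₙ obtained by repeating the last digit is an ascent sequence of length n+1 avoiding 0021. -/
lemma numAscents_append_le (b : List ℕ) (c : ℕ) : numAscents b ≤ numAscents (b ++ [c]) := by
  induction b with
  | nil => simp [numAscents]
  | cons x t ih =>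
    cases t with
    | nil => simp [numAscents]
    | cons y s =>
      simp only [numAscents, List.cons_append, List.tail_cons, List.zip_cons_cons,
        List.filter_cons] at ih ⊢
      by_cases h : x < y
      · simpa [h] using ih
      · simpa [h] using ih

lemma sublist_snoc {u b : List ℕ} {c : ℕ} (h : u.Sublist (b ++ [c])) :
    u.Sublist b ∨ ∃ v, u = v ++ [c] ∧ v.Sublist b := by
  rw [List.sublist_append_iff] at h
  obtain ⟨l1, l2, rfl, h1, h2⟩ := h
  rcases List.sublist_singleton.1 h2 with rfl | rfl
  · left; simpa using h1
  · right; exact ⟨l1, rfl, h1⟩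

/-- repeating the last digit of a `0021`-avoiding ascent
sequence gives a `0021`-avoiding ascent sequence. -/
theorem repeat_last_mem_0021 (n : ℕ) (hn : 1 ≤ n) (a : List ℕ)
    (ha : a ∈ AvSet [[0,0,2,1]] n) :
    a ++ [a.getLastD 0] ∈ AvSet [[0,0,2,1]] (n+1) := by
  obtain ⟨hlen, ⟨hhead, hasc⟩, hav⟩ := ha
  rcases List.eq_nil_or_concat a with rfl | ⟨b, c, rfl⟩
  · simp at hhead
  have hl : (b ++ [c]).getLastD 0 = c := by simp
  simp only [List.concat_eq_append] at *
  rw [hl]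
  refine ⟨by simp at hlen ⊢; omega, ⟨by simp at hhead ⊢; simp [hhead], ?_⟩, ?_⟩
  · intro i h0 hi
    rcases Nat.lt_or_ge i (b ++ [c]).length with h | h
    · have := hasc i h0 h
      rw [List.getD_append _ _ _ _ h, List.take_append_of_le_length h.le]
      exact this
    · have hi' : i = (b ++ [c]).length := by
        simp only [List.length_append, List.length_singleton] at hi h ⊢; omega
      subst hi'
      rw [List.getD_append_right _ _ _ _ le_rfl, List.take_left]
      simp only [Nat.sub_self, List.getD_cons_zero]
      rcases Nat.eq_zero_or_pos b.length with hb | hb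
      · have : b = [] := List.length_eq_zero_iff.1 hb
        subst this
        simp at hhead
        simp [hhead]
      · have := hasc b.length hb (by simp)
        rw [List.getD_append_right _ _ _ _ le_rfl, List.take_left] at this
        simp only [Nat.sub_self, List.getD_cons_zero] at this
        have := numAscents_append_le b c
        omega
  · intro p hp
    have hav' := hav p hp
    simp only [List.mem_singleton] at hp
    subst hp
    rintro ⟨u, hu, hul, hpat⟩
    apply hav'
    refine ⟨u, ?_, hul, hpat⟩
    rcases sublist_snoc hu with h | ⟨v, rfl, hv⟩
    · exact h
    rcases sublist_snoc hv with h | ⟨w, rfl, hw⟩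
    · exact h.append_right [c]
    exfalso
    have h23 := (hpat 2 3 (by simp) (by simp)).2
    simp only [List.length_append, List.length_cons, List.length_nil] at hul
    match w, hul with
    | [x, y], _ => simp at h23
end
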